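/- Effective interaction potential in the n-th Landau level (interaction part of Theorem 2.1, matrix-element form): let w : ℝ² → ℂ be smooth with w and all its partial derivatives polynomially bounded, let n ∈ ℕ, and let φ_{n,m}(z) = (π n! m!)^{−1/2} ((z̄ − ∂_z)^n (w ↦ w^m))(z) e^{−|z|²/2}. Then for all m₁, m₂, m₁′, m₂′ ∈ ℕ: ∫_{ℝ²}∫_{ℝ²} w(r₁ − r₂) · conj(φ_{n,m₁′}(r₁)) conj(φ_{n,m₂′}(r₂)) · φ_{n,m₁}(r₁) φ_{n,m₂}(r₂) d²r₁ d²r₂ = ∫_{ℝ²}∫_{ℝ²} wₙ(r₁ − r₂) · conj(φ_{0,m₁′}(r₁)) conj(φ_{0,m₂′}(r₂)) · φ_{0,m₁}(r₁) φ_{0,m₂}(r₂) d²r₁ d²r₂, where wₙ = Lₙ(−¼Δ)² w is the result of applying the operator Lₙ(−¼Δ) = Σ_{l=0}^{n} C(n,l)(1/l!)(¼Δ)^l twice to w, with Δ the Laplacian on ℝ². Thus two-body matrix elements of w in the n-th Landau level equal those of the effective interaction wₙ in the lowest Landau level. -/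

import Mathlib

open MeasureTheory

noncomputable section

/-- Wirtinger derivative `∂_z F = ½(∂_x F − i ∂_y F)`. -/
def dz (F : ℂ → ℂ) (z : ℂ) : ℂ :=
  (1 / 2 : ℂ) * (fderiv ℝ F z 1 - Complex.I * fderiv ℝ F z Complex.I)

/-- The operator `z̄ − ∂_z`. -/
def Tbar (F : ℂ → ℂ) : ℂ → ℂ := fun z => (starRingEnd ℂ) z * F z - dz F z

/-- The Landau-level basis function `φ_{n,m}` (units `B = 2`). -/
def phi (n m : ℕ) (z : ℂ) : ℂ :=
  (Real.sqrt (Real.pi * n.factorial * m.factorial) : ℂ)⁻¹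
    * (Tbar^[n] (fun w => w ^ m)) z * Complex.exp (-(Complex.normSq z : ℂ) / 2)

/-- The Laplacian `Δ = ∂_x² + ∂_y²` on functions `ℝ² ≃ ℂ → ℂ`. -/
def lapC (F : ℂ → ℂ) : ℂ → ℂ :=
  fun z => fderiv ℝ (fun w => fderiv ℝ F w 1) z 1
    + fderiv ℝ (fun w => fderiv ℝ F w Complex.I) z Complex.I

/-- The operator `Lₙ(−¼Δ) = Σ_{l=0}^n C(n,l)(1/l!)(¼Δ)^l`. -/
def LagOpV (n : ℕ) (V : ℂ → ℂ) : ℂ → ℂ :=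
  fun z => ∑ l ∈ Finset.range (n + 1),
    (n.choose l : ℂ) * (1 / 4 : ℂ) ^ l * (l.factorial : ℂ)⁻¹ * (lapC^[l] V) z

open Function ComplexConjugate

/-- The operator `½(∂_x + c ∂_y)`; `c = -i` gives `∂_z` and `c = i` gives `∂_{z̄}`. -/
def wirtinger (c : ℂ) (F : ℂ → ℂ) (z : ℂ) : ℂ :=
  (1 / 2 : ℂ) * (fderiv ℝ F z 1 + c * fderiv ℝ F z Complex.I)

theorem dz_eq_wirtinger : dz = wirtinger (-Complex.I) := by
  ext F z
  simp only [dz, wirtinger]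
  ring

theorem Function.HasTemperateGrowth.differentiable {F : ℂ → ℂ} (hF : HasTemperateGrowth F) :
    Differentiable ℝ F :=
  hF.1.differentiable (by simp)

theorem Function.HasTemperateGrowth.fderiv_apply {F : ℂ → ℂ} (hF : HasTemperateGrowth F) (v : ℂ) :
    HasTemperateGrowth (fun z => fderiv ℝ F z v) := by
  have h : HasTemperateGrowth (fderiv ℝ F) := by
    refine ⟨hF.1.fderiv_right (by simp), fun n => ?_⟩
    obtain ⟨k, C, h⟩ := hF.2 (n + 1)
    exact ⟨k, C, fun x => by simpa only [norm_iteratedFDeriv_fderiv] using h x⟩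
  exact (ContinuousLinearMap.apply ℝ ℂ v).hasTemperateGrowth.comp h

theorem Function.HasTemperateGrowth.wirtinger {F : ℂ → ℂ} (hF : HasTemperateGrowth F) (c : ℂ) :
    HasTemperateGrowth (wirtinger c F) := by
  have h1 := hF.fderiv_apply 1
  have h2 := hF.fderiv_apply Complex.I
  unfold _root_.wirtinger
  fun_prop

theorem Function.HasTemperateGrowth.wirtinger_iterate {F : ℂ → ℂ} (hF : HasTemperateGrowth F)
    (c : ℂ) (n : ℕ) : HasTemperateGrowth ((_root_.wirtinger c)^[n] F) := by
  induction n with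
  | zero => exact hF
  | succ n ih =>
    rw [iterate_succ_apply']
    exact ih.wirtinger c

theorem hasTemperateGrowth_conj : HasTemperateGrowth (fun z : ℂ => conj z) :=
  Complex.conjCLE.hasTemperateGrowth

theorem Function.HasTemperateGrowth.conj {F : ℂ → ℂ} (hF : HasTemperateGrowth F) :
    HasTemperateGrowth (fun z => conj (F z)) :=
  hasTemperateGrowth_conj.comp hF

theorem Function.HasTemperateGrowth.Tbar {F : ℂ → ℂ} (hF : HasTemperateGrowth F) :
    HasTemperateGrowth (Tbar F) := by
  have h1 := hF.wirtinger (-Complex.I)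
  have h2 := hasTemperateGrowth_conj
  unfold _root_.Tbar
  rw [dz_eq_wirtinger]
  fun_prop

theorem Function.HasTemperateGrowth.Tbar_iterate {F : ℂ → ℂ} (hF : HasTemperateGrowth F) (n : ℕ) :
    HasTemperateGrowth (_root_.Tbar^[n] F) := by
  induction n with
  | zero => exact hF
  | succ n ih =>
    rw [iterate_succ_apply']
    exact ih.Tbar

theorem wirtinger_mul {F G : ℂ → ℂ} (hF : Differentiable ℝ F) (hG : Differentiable ℝ G) (c : ℂ) :
    wirtinger c (fun z => F z * G z) =
      fun z => wirtinger c F z * G z + F z * wirtinger c G z := by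
  ext z
  simp only [wirtinger, fderiv_fun_mul (hF z) (hG z), _root_.add_apply,
    _root_.smul_apply, smul_eq_mul]
  ring

theorem wirtinger_sub {F G : ℂ → ℂ} (hF : Differentiable ℝ F) (hG : Differentiable ℝ G) (c : ℂ) :
    wirtinger c (fun z => F z - G z) = fun z => wirtinger c F z - wirtinger c G z := by
  ext z
  simp only [wirtinger, fderiv_fun_sub (hF z) (hG z), _root_.sub_apply]
  ring

theorem wirtinger_const_mul {F : ℂ → ℂ} (hF : Differentiable ℝ F) (c a : ℂ) :
    wirtinger c (fun z => a * F z) = fun z => a * wirtinger c F z := by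
  ext z
  simp only [wirtinger, fderiv_const_mul (hF z), _root_.smul_apply, smul_eq_mul]
  ring

theorem wirtinger_conj {F : ℂ → ℂ} (hF : Differentiable ℝ F) (c : ℂ) :
    wirtinger c (fun z => conj (F z)) = fun z => conj (wirtinger (conj c) F z) := by
  ext z
  have h : fderiv ℝ (fun z => conj (F z)) z =
      (Complex.conjCLE : ℂ →L[ℝ] ℂ).comp (fderiv ℝ F z) :=
    ((Complex.conjCLE : ℂ →L[ℝ] ℂ).hasFDerivAt.comp z (hF z).hasFDerivAt).fderiv
  simp [wirtinger, h, map_ofNat]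

theorem wirtinger_I_conj : wirtinger Complex.I (fun z => conj z) = fun _ => 1 := by
  ext z
  have h : fderiv ℝ (fun z => conj z) z = (Complex.conjCLE : ℂ →L[ℝ] ℂ) :=
    (Complex.conjCLE : ℂ →L[ℝ] ℂ).hasFDerivAt.fderiv
  simp [wirtinger, h]
  norm_num

theorem wirtinger_I_of_differentiable {f : ℂ → ℂ} (hf : Differentiable ℂ f) :
    wirtinger Complex.I f = 0 := by
  ext z
  simp only [wirtinger, (hf z).fderiv_restrictScalars ℝ, ContinuousLinearMap.coe_restrictScalars']
  have h : fderiv ℂ f z Complex.I = Complex.I * fderiv ℂ f z 1 := by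
    rw [← smul_eq_mul, ← map_smul, smul_eq_mul, mul_one]
  rw [h, ← mul_assoc, Complex.I_mul_I]
  simp

theorem fderiv_fderiv_apply {F : ℂ → ℂ} (hF : HasTemperateGrowth F) (u v z : ℂ) :
    fderiv ℝ (fun w => fderiv ℝ F w u) z v = fderiv ℝ (fderiv ℝ F) z v u := by
  have h : DifferentiableAt ℝ (fderiv ℝ F) z :=
    ((hF.1.fderiv_right (m := (⊤ : ℕ∞)) (by simp)).differentiable (by simp)) z
  rw [fderiv_clm_apply h (differentiableAt_const u)]
  simp

theorem fderiv_fderiv_comm {F : ℂ → ℂ} (hF : HasTemperateGrowth F) (u v z : ℂ) :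
    fderiv ℝ (fun w => fderiv ℝ F w u) z v = fderiv ℝ (fun w => fderiv ℝ F w v) z u := by
  rw [fderiv_fderiv_apply hF, fderiv_fderiv_apply hF]
  exact ((contDiff_infty.1 hF.1 2).contDiffAt.isSymmSndFDerivAt (by simp)).eq v u

theorem wirtinger_wirtinger {F : ℂ → ℂ} (hF : HasTemperateGrowth F) (c d z : ℂ) :
    wirtinger c (wirtinger d F) z = (1 / 4 : ℂ) *
      (fderiv ℝ (fun w => fderiv ℝ F w 1) z 1
        + (c + d) * fderiv ℝ (fun w => fderiv ℝ F w 1) z Complex.I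
        + c * d * fderiv ℝ (fun w => fderiv ℝ F w Complex.I) z Complex.I) := by
  have h1 := (hF.fderiv_apply 1).differentiable z
  have h2 := (hF.fderiv_apply Complex.I).differentiable z
  have h (v : ℂ) : fderiv ℝ (wirtinger d F) z v = (1 / 2 : ℂ) *
      (fderiv ℝ (fun w => fderiv ℝ F w 1) z v
        + d * fderiv ℝ (fun w => fderiv ℝ F w Complex.I) z v) := by
    unfold wirtinger
    rw [fderiv_const_mul (by fun_prop), fderiv_fun_add h1 (by fun_prop), fderiv_const_mul h2]
    simp [mul_add]
  rw [wirtinger, h, h, fderiv_fderiv_comm hF Complex.I 1]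
  ring

theorem wirtinger_comm {F : ℂ → ℂ} (hF : HasTemperateGrowth F) (c d : ℂ) :
    wirtinger c (wirtinger d F) = wirtinger d (wirtinger c F) := by
  ext z
  rw [wirtinger_wirtinger hF, wirtinger_wirtinger hF]
  ring

theorem lapC_eq_wirtinger {F : ℂ → ℂ} (hF : HasTemperateGrowth F) :
    lapC F = fun z => 4 * wirtinger Complex.I (wirtinger (-Complex.I) F) z := by
  ext z
  rw [wirtinger_wirtinger hF]
  simp [lapC]

theorem wirtinger_iterate_comm {F : ℂ → ℂ} (hF : HasTemperateGrowth F) (c d : ℂ) (n : ℕ) :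
    wirtinger c ((wirtinger d)^[n] F) = (wirtinger d)^[n] (wirtinger c F) := by
  induction n with
  | zero => rfl
  | succ n ih =>
    rw [iterate_succ_apply', iterate_succ_apply', wirtinger_comm (hF.wirtinger_iterate d n), ih]

theorem lapC_iterate {F : ℂ → ℂ} (hF : HasTemperateGrowth F) (l : ℕ) :
    lapC^[l] F = fun z => 4 ^ l *
      (wirtinger Complex.I)^[l] ((wirtinger (-Complex.I))^[l] F) z := by
  induction l with
  | zero => simp
  | succ l ih =>
    have h := (hF.wirtinger_iterate (-Complex.I) l).wirtinger_iterate Complex.I l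
    have h' := h.wirtinger (-Complex.I)
    have h4 := (HasTemperateGrowth.const ((4 : ℂ) ^ l)).fun_mul h
    rw [iterate_succ_apply', ih, lapC_eq_wirtinger h4,
      wirtinger_const_mul h.differentiable, wirtinger_const_mul h'.differentiable,
      wirtinger_iterate_comm (hF.wirtinger_iterate _ l), iterate_succ_apply',
      iterate_succ_apply']
    ext z
    ring

theorem Function.HasTemperateGrowth.lapC_iterate {F : ℂ → ℂ} (hF : HasTemperateGrowth F) (l : ℕ) :
    HasTemperateGrowth (lapC^[l] F) := by
  have h := (hF.wirtinger_iterate (-Complex.I) l).wirtinger_iterate Complex.I l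
  rw [_root_.lapC_iterate hF]
  fun_prop

theorem Function.HasTemperateGrowth.LagOpV {F : ℂ → ℂ} (hF : HasTemperateGrowth F) (n : ℕ) :
    HasTemperateGrowth (LagOpV n F) := by
  have h := hF.lapC_iterate
  refine HasTemperateGrowth.sum fun l _ => ?_
  have := h l
  fun_prop

theorem wirtinger_I_Tbar {F : ℂ → ℂ} (hF : HasTemperateGrowth F) :
    wirtinger Complex.I (Tbar F) = fun z => F z + Tbar (wirtinger Complex.I F) z := by
  have h1 := hasTemperateGrowth_conj
  have h2 := hF.wirtinger (-Complex.I)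
  have h3 : HasTemperateGrowth (fun z => conj z * F z) := by fun_prop
  unfold Tbar
  rw [dz_eq_wirtinger, wirtinger_sub h3.differentiable h2.differentiable,
    wirtinger_mul h1.differentiable hF.differentiable, wirtinger_I_conj, wirtinger_comm hF]
  ext z
  ring

theorem Tbar_const_mul {F : ℂ → ℂ} (hF : Differentiable ℝ F) (a : ℂ) :
    Tbar (fun z => a * F z) = fun z => a * Tbar F z := by
  unfold Tbar
  rw [dz_eq_wirtinger, wirtinger_const_mul hF]
  ext z
  ring

theorem wirtinger_I_Tbar_iterate {f : ℂ → ℂ} (hf : HasTemperateGrowth f)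
    (hf' : Differentiable ℂ f) (n : ℕ) :
    wirtinger Complex.I (Tbar^[n] f) = fun z => n * Tbar^[n - 1] f z := by
  induction n with
  | zero =>
    ext z
    simp [wirtinger_I_of_differentiable hf']
  | succ n ih =>
    rw [iterate_succ_apply', wirtinger_I_Tbar (hf.Tbar_iterate n), ih,
      Tbar_const_mul (hf.Tbar_iterate _).differentiable]
    ext z
    rcases n with - | n
    · simp
    · simp only [Nat.add_sub_cancel, iterate_succ_apply']
      push_cast
      ring

theorem integrable_one_add_norm_pow_mul_exp (k : ℕ) :
    Integrable (fun z : ℂ => (1 + ‖z‖) ^ k * Real.exp (-‖z‖ ^ 2)) := by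
  have h : Integrable (fun z : ℂ => Real.exp (-(1 / 2) * ‖z‖ ^ 2)) := by
    have h := (GaussianFourier.integrable_cexp_neg_mul_sq_norm_add (V := ℂ) (b := 1 / 2)
      (by norm_num) 0 0).norm
    refine h.congr (Filter.Eventually.of_forall fun z => ?_)
    simp [Complex.norm_exp, ← Complex.ofReal_pow]
  refine (h.const_mul (k.factorial * Real.exp 2)).mono'
    (by fun_prop) (Filter.Eventually.of_forall fun z => ?_)
  rw [Real.norm_of_nonneg (by positivity)]
  have h1 : (1 + ‖z‖) ^ k ≤ k.factorial * Real.exp (1 + ‖z‖) := by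
    have := Real.pow_div_factorial_le_exp (1 + ‖z‖) (by positivity) k
    rw [div_le_iff₀ (by positivity)] at this
    linarith
  calc (1 + ‖z‖) ^ k * Real.exp (-‖z‖ ^ 2)
      ≤ k.factorial * Real.exp (1 + ‖z‖) * Real.exp (-‖z‖ ^ 2) := by gcongr
    _ = k.factorial * Real.exp (1 + ‖z‖ + -‖z‖ ^ 2) := by rw [mul_assoc, ← Real.exp_add]
    _ ≤ k.factorial * Real.exp (2 + -(1 / 2) * ‖z‖ ^ 2) := by
        refine mul_le_mul_of_nonneg_left (Real.exp_le_exp.mpr ?_) (by positivity)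
        nlinarith [sq_nonneg (‖z‖ - 1)]
    _ = _ := by rw [mul_assoc, ← Real.exp_add]

theorem Function.HasTemperateGrowth.norm_le {E : Type*} [NormedAddCommGroup E] [NormedSpace ℝ E]
    {F : E → ℂ} (hF : HasTemperateGrowth F) :
    ∃ (k : ℕ) (C : ℝ), ∀ x, ‖F x‖ ≤ C * (1 + ‖x‖) ^ k := by
  simpa using hF.2 0

/-- The Gaussian weight `exp (-|z|²)`. -/
def gaussWeight (z : ℂ) : ℂ := Complex.exp (-(Complex.normSq z : ℂ))

theorem norm_gaussWeight (z : ℂ) : ‖gaussWeight z‖ = Real.exp (-‖z‖ ^ 2) := by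
  rw [gaussWeight, Complex.norm_exp, Complex.neg_re, Complex.ofReal_re, Complex.normSq_eq_norm_sq]

theorem conj_gaussWeight (z : ℂ) : conj (gaussWeight z) = gaussWeight z := by
  simp [gaussWeight, ← Complex.exp_conj]

theorem hasFDerivAt_gaussWeight (z : ℂ) :
    HasFDerivAt gaussWeight (gaussWeight z • -(z • (Complex.conjCLE : ℂ →L[ℝ] ℂ)
      + conj z • ContinuousLinearMap.id ℝ ℂ)) z := by
  have h : HasFDerivAt (fun z : ℂ => -(z * conj z)) (-(z • (Complex.conjCLE : ℂ →L[ℝ] ℂ)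
      + conj z • ContinuousLinearMap.id ℝ ℂ)) z :=
    ((hasFDerivAt_id z).mul (Complex.conjCLE : ℂ →L[ℝ] ℂ).hasFDerivAt).neg
  have h2 := h.cexp
  unfold gaussWeight
  simpa only [Complex.mul_conj] using h2

theorem differentiable_gaussWeight : Differentiable ℝ gaussWeight :=
  fun z => (hasFDerivAt_gaussWeight z).differentiableAt

theorem integrable_mul_gaussWeight {F : ℂ → ℂ} (hF : HasTemperateGrowth F) :
    Integrable (fun z => F z * gaussWeight z) := by
  obtain ⟨k, C, h⟩ := hF.norm_le
  refine ((integrable_one_add_norm_pow_mul_exp k).const_mul C).mono' ?_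
    (Filter.Eventually.of_forall fun z => ?_)
  · exact (hF.1.continuous.mul differentiable_gaussWeight.continuous).aestronglyMeasurable
  · rw [norm_mul, norm_gaussWeight, ← mul_assoc]
    gcongr
    exact h z

theorem fderiv_gaussWeight_apply (z v : ℂ) :
    fderiv ℝ gaussWeight z v = -(z * conj v + conj z * v) * gaussWeight z := by
  rw [(hasFDerivAt_gaussWeight z).fderiv]
  simp
  ring

theorem integral_fderiv_mul_gaussWeight {F : ℂ → ℂ} (hF : HasTemperateGrowth F) (v : ℂ) :
    ∫ z, fderiv ℝ F z v * gaussWeight z =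
      ∫ z, F z * (z * conj v + conj z * v) * gaussWeight z := by
  have h1 := hasTemperateGrowth_conj
  have h2 : HasTemperateGrowth (fun z => F z * (z * conj v + conj z * v)) := by fun_prop
  have h := integral_mul_fderiv_eq_neg_fderiv_mul_of_integrable (μ := volume) (v := v)
    (integrable_mul_gaussWeight (hF.fderiv_apply v))
    (by
      simp only [fderiv_gaussWeight_apply]
      refine (integrable_mul_gaussWeight h2).neg.congr (Filter.Eventually.of_forall fun z => ?_)
      simp only [Pi.neg_apply]
      ring)
    (integrable_mul_gaussWeight hF) (fun z _ => hF.differentiable z)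
    (fun z _ => differentiable_gaussWeight z)
  rw [eq_neg_iff_add_eq_zero, add_comm, ← eq_neg_iff_add_eq_zero, ← integral_neg] at h
  rw [h]
  congr 1
  ext z
  rw [fderiv_gaussWeight_apply]
  ring

theorem integral_wirtinger_mul_gaussWeight {F : ℂ → ℂ} (hF : HasTemperateGrowth F) :
    ∫ z, wirtinger (-Complex.I) F z * gaussWeight z = ∫ z, conj z * F z * gaussWeight z := by
  have h0 := hasTemperateGrowth_conj
  have hint (v : ℂ) : Integrable
      (fun z => F z * (z * conj v + conj z * v) * gaussWeight z) :=
    integrable_mul_gaussWeight (by fun_prop)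
  have h1 : ∀ z, wirtinger (-Complex.I) F z * gaussWeight z =
      (1 / 2 : ℂ) * (fderiv ℝ F z 1 * gaussWeight z) +
        (1 / 2 * -Complex.I) * (fderiv ℝ F z Complex.I * gaussWeight z) := fun z => by
    rw [wirtinger]
    ring
  simp_rw [h1]
  rw [integral_add ((integrable_mul_gaussWeight (hF.fderiv_apply _)).const_mul _)
    ((integrable_mul_gaussWeight (hF.fderiv_apply _)).const_mul _), integral_const_mul,
    integral_const_mul, integral_fderiv_mul_gaussWeight hF, integral_fderiv_mul_gaussWeight hF,
    ← integral_const_mul, ← integral_const_mul,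
    ← integral_add ((hint _).const_mul _) ((hint _).const_mul _)]
  congr 1
  ext z
  simp only [map_one, Complex.conj_I]
  linear_combination (1 / 2) * (z - conj z) * F z * gaussWeight z * Complex.I_mul_I

theorem integral_mul_Tbar {F G : ℂ → ℂ} (hF : HasTemperateGrowth F) (hG : HasTemperateGrowth G) :
    ∫ z, F z * Tbar G z * gaussWeight z =
      ∫ z, wirtinger (-Complex.I) F z * G z * gaussWeight z := by
  have h0 := hasTemperateGrowth_conj
  have hF' := hF.wirtinger (-Complex.I)
  have hG' := hG.wirtinger (-Complex.I)
  have h1 := integral_wirtinger_mul_gaussWeight (hF.fun_mul hG)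
  rw [wirtinger_mul hF.differentiable hG.differentiable] at h1
  have h2 : ∀ z, F z * Tbar G z * gaussWeight z = conj z * (F z * G z) * gaussWeight z
      - F z * wirtinger (-Complex.I) G z * gaussWeight z := fun z => by
    rw [Tbar, dz_eq_wirtinger]
    ring
  simp_rw [h2]
  rw [integral_sub (integrable_mul_gaussWeight (by fun_prop))
    (integrable_mul_gaussWeight (by fun_prop)), ← h1,
    ← integral_sub (integrable_mul_gaussWeight (by fun_prop))
    (integrable_mul_gaussWeight (by fun_prop))]
  congr 1
  ext z
  ring

theorem integral_mul_conj_Tbar {F G : ℂ → ℂ} (hF : HasTemperateGrowth F)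
    (hG : HasTemperateGrowth G) :
    ∫ z, F z * conj (Tbar G z) * gaussWeight z =
      ∫ z, wirtinger Complex.I F z * conj (G z) * gaussWeight z := by
  have h := congrArg (starRingEnd ℂ) (integral_mul_Tbar hF.conj hG)
  rw [wirtinger_conj hF.differentiable, ← integral_conj, ← integral_conj] at h
  simpa [conj_gaussWeight] using h

/-- Closed form of a recursion that either raises `k`, or lowers `a` with weight `a`. -/
theorem eq_sum_of_contraction_recursion (J : ℕ → ℕ → ℕ → ℂ)
    (hJ : ∀ k a b, J k a (b + 1) = J (k + 1) a b + a * J k (a - 1) b) (b : ℕ) :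
    ∀ k a, J k a b = ∑ ij ∈ Finset.HasAntidiagonal.antidiagonal b,
      (b.choose ij.1 : ℂ) * ((a.descFactorial ij.2 : ℂ) * J (k + ij.1) (a - ij.2) 0) := by
  induction b with
  | zero => simp
  | succ b ih =>
    intro k a
    rw [hJ, ih, ih, Finset.sum_antidiagonal_choose_succ_mul
      (fun i j => (a.descFactorial j : ℂ) * J (k + i) (a - j) 0), add_comm, Finset.mul_sum]
    congr 1
    · refine Finset.sum_congr rfl fun ij _ => ?_
      have h : a.descFactorial (ij.2 + 1) = a * (a - 1).descFactorial ij.2 := by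
        rcases a with - | a
        · simp
        · rw [Nat.succ_descFactorial_succ, Nat.add_sub_cancel]
      rw [h, Nat.sub_sub, add_comm 1]
      push_cast
      ring
    · refine Finset.sum_congr rfl fun ij hij => ?_
      rw [Finset.HasAntidiagonal.mem_antidiagonal] at hij
      rw [← Nat.choose_symm_of_eq_add hij.symm, add_assoc, add_comm 1]

theorem integral_mul_conj_Tbar_iterate {V f g : ℂ → ℂ} (hV : HasTemperateGrowth V)
    (hf : HasTemperateGrowth f) (hg : HasTemperateGrowth g) (hg' : Differentiable ℂ g) (a : ℕ) :
    ∫ z, V z * conj (Tbar^[a] f z) * g z * gaussWeight z =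
      ∫ z, (wirtinger Complex.I)^[a] V z * conj (f z) * g z * gaussWeight z := by
  induction a generalizing V with
  | zero => rfl
  | succ a ih =>
    have h := integral_mul_conj_Tbar (hV.fun_mul hg) (hf.Tbar_iterate a)
    rw [wirtinger_mul hV.differentiable hg.differentiable, wirtinger_I_of_differentiable hg'] at h
    simp only [iterate_succ_apply' Tbar, iterate_succ_apply, ← ih (hV.wirtinger _)]
    convert h using 3
    · ring
    · simp only [Pi.zero_apply]
      ring

theorem integral_Tbar_iterate_succ {V f g : ℂ → ℂ} (hV : HasTemperateGrowth V)
    (hf : HasTemperateGrowth f) (hf' : Differentiable ℂ f) (hg : HasTemperateGrowth g) (a b : ℕ) :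
    ∫ z, V z * conj (Tbar^[a] f z) * Tbar^[b + 1] g z * gaussWeight z =
      (∫ z, wirtinger (-Complex.I) V z * conj (Tbar^[a] f z) * Tbar^[b] g z * gaussWeight z)
      + a * ∫ z, V z * conj (Tbar^[a - 1] f z) * Tbar^[b] g z * gaussWeight z := by
  have hfa := (hf.Tbar_iterate a).conj
  have hfa' := (hf.Tbar_iterate (a - 1)).conj
  have hgb := hg.Tbar_iterate b
  have hV' := hV.wirtinger (-Complex.I)
  have h := integral_mul_Tbar (hV.fun_mul hfa) hgb
  rw [wirtinger_mul hV.differentiable hfa.differentiable,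
    wirtinger_conj (hf.Tbar_iterate a).differentiable, map_neg, Complex.conj_I, neg_neg,
    wirtinger_I_Tbar_iterate hf hf'] at h
  rw [iterate_succ_apply', h, ← integral_const_mul,
    ← integral_add (integrable_mul_gaussWeight (by fun_prop))
      ((integrable_mul_gaussWeight (by fun_prop)).const_mul _)]
  congr 1
  ext z
  simp only [map_mul, map_natCast]
  ring

theorem integral_Tbar_iterate {V f g : ℂ → ℂ} (hV : HasTemperateGrowth V)
    (hf : HasTemperateGrowth f) (hf' : Differentiable ℂ f)
    (hg : HasTemperateGrowth g) (hg' : Differentiable ℂ g) (n : ℕ) :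
    ∫ z, V z * conj (Tbar^[n] f z) * Tbar^[n] g z * gaussWeight z =
      n.factorial * ∫ z, LagOpV n V z * conj (f z) * g z * gaussWeight z := by
  have h := eq_sum_of_contraction_recursion
    (fun k a b => ∫ z, (wirtinger (-Complex.I))^[k] V z * conj (Tbar^[a] f z) * Tbar^[b] g z
      * gaussWeight z)
    (fun k a b => by
      simpa only [iterate_succ_apply'] using
        integral_Tbar_iterate_succ (hV.wirtinger_iterate (-Complex.I) k) hf hf' hg a b) n 0 n
  have hfc := hf.conj
  have hint (l : ℕ) : Integrable
      (fun z => (lapC^[l] V) z * conj (f z) * g z * gaussWeight z) := by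
    have := hV.lapC_iterate l
    exact integrable_mul_gaussWeight (by fun_prop)
  have hL : ∀ z, LagOpV n V z * conj (f z) * g z * gaussWeight z =
      ∑ l ∈ Finset.range (n + 1), ((n.choose l : ℂ) * (1 / 4 : ℂ) ^ l * (l.factorial : ℂ)⁻¹) *
        ((lapC^[l] V) z * conj (f z) * g z * gaussWeight z) := fun z => by
    simp only [LagOpV, Finset.sum_mul]
    refine Finset.sum_congr rfl fun l _ => ?_
    ring
  simp_rw [hL]
  rw [integral_finsetSum _ fun l _ => (hint l).const_mul _, Finset.mul_sum]
  simp only [iterate_zero, id_eq] at h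
  rw [h, Finset.Nat.sum_antidiagonal_eq_sum_range_succ_mk]
  refine Finset.sum_congr rfl fun l hl => ?_
  have hl' : l ≤ n := Nat.lt_succ_iff.mp (Finset.mem_range.mp hl)
  have hfac : (n.descFactorial (n - l) : ℂ) * l.factorial = n.factorial := by
    have := Nat.factorial_mul_descFactorial (Nat.sub_le n l)
    rw [Nat.sub_sub_self hl'] at this
    rw [mul_comm]
    exact_mod_cast this
  have hfac0 : (l.factorial : ℂ) ≠ 0 := by exact_mod_cast l.factorial_ne_zero
  simp only [zero_add, Nat.sub_sub_self hl',
    integral_mul_conj_Tbar_iterate (hV.wirtinger_iterate (-Complex.I) l) hf hg hg']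
  rw [integral_const_mul, lapC_iterate hV]
  simp only [mul_assoc ((4 : ℂ) ^ l)]
  rw [integral_const_mul, ← hfac]
  field_simp
  rw [mul_assoc, ← mul_pow]
  norm_num

theorem hasTemperateGrowth_affine (s : ℝ) (c : ℂ) :
    HasTemperateGrowth (fun z : ℂ => (s : ℂ) * z + c) := by
  fun_prop

theorem wirtinger_comp_affine {F : ℂ → ℂ} (hF : Differentiable ℝ F) (d : ℂ) (s : ℝ) (c : ℂ) :
    wirtinger d (fun z => F (s * z + c)) = fun z => s * wirtinger d F (s * z + c) := by
  ext z
  have h1 : HasFDerivAt (fun z : ℂ => (s : ℂ) * z + c)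
      ((s : ℂ) • ContinuousLinearMap.id ℝ ℂ) z :=
    ((hasFDerivAt_id z).const_mul (s : ℂ)).add_const c
  have h2 : fderiv ℝ (fun z => F (s * z + c)) z =
      (fderiv ℝ F (s * z + c)).comp ((s : ℂ) • ContinuousLinearMap.id ℝ ℂ) :=
    ((hF _).hasFDerivAt.comp z h1).fderiv
  have h3 (v : ℂ) : fderiv ℝ F (s * z + c) (s * v) = s * fderiv ℝ F (s * z + c) v := by
    simpa only [Complex.real_smul] using map_smul (fderiv ℝ F (s * z + c)) s v
  have h4 (v : ℂ) : fderiv ℝ (fun z => F (s * z + c)) z v = s * fderiv ℝ F (s * z + c) v := by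
    rw [h2, ← h3]
    simp
  simp only [wirtinger, h4]
  ring

theorem lapC_comp_affine {F : ℂ → ℂ} (hF : HasTemperateGrowth F) {s : ℝ} (hs : s * s = 1) (c : ℂ) :
    lapC (fun z => F (s * z + c)) = fun z => lapC F (s * z + c) := by
  have hs' : (s : ℂ) * s = 1 := mod_cast hs
  have h1 := hF.wirtinger (-Complex.I)
  have h0 : HasTemperateGrowth (fun z => F (s * z + c)) := hF.comp (hasTemperateGrowth_affine s c)
  have h2 : HasTemperateGrowth (fun z => wirtinger (-Complex.I) F (s * z + c)) :=
    h1.comp (hasTemperateGrowth_affine s c)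
  rw [lapC_eq_wirtinger hF, lapC_eq_wirtinger h0,
    wirtinger_comp_affine hF.differentiable,
    wirtinger_const_mul h2.differentiable, wirtinger_comp_affine h1.differentiable]
  ext z
  linear_combination 4 * wirtinger Complex.I (wirtinger (-Complex.I) F) (s * z + c) * hs'

theorem LagOpV_comp_affine {F : ℂ → ℂ} (hF : HasTemperateGrowth F) (n : ℕ) {s : ℝ}
    (hs : s * s = 1) (c : ℂ) :
    LagOpV n (fun z => F (s * z + c)) = fun z => LagOpV n F (s * z + c) := by
  have h (l : ℕ) : lapC^[l] (fun z => F (s * z + c)) = fun z => lapC^[l] F (s * z + c) := by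
    induction l with
    | zero => rfl
    | succ l ih =>
      rw [iterate_succ_apply', iterate_succ_apply', ih, lapC_comp_affine (hF.lapC_iterate l) hs]
  ext z
  simp [LagOpV, h]

theorem LagOpV_comp_sub_const {F : ℂ → ℂ} (hF : HasTemperateGrowth F) (n : ℕ) (c : ℂ) :
    LagOpV n (fun z => F (z - c)) = fun z => LagOpV n F (z - c) := by
  simpa [sub_eq_add_neg] using LagOpV_comp_affine hF n (s := 1) (by norm_num) (-c)

theorem LagOpV_comp_const_sub {F : ℂ → ℂ} (hF : HasTemperateGrowth F) (n : ℕ) (c : ℂ) :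
    LagOpV n (fun z => F (c - z)) = fun z => LagOpV n F (c - z) := by
  simpa [neg_add_eq_sub] using LagOpV_comp_affine hF n (s := -1) (by norm_num) c

theorem hasTemperateGrowth_pow (m : ℕ) : HasTemperateGrowth (fun z : ℂ => z ^ m) := by
  fun_prop

theorem conj_phi_mul_phi (n m m' : ℕ) (z : ℂ) :
    conj (phi n m' z) * phi n m z =
      (Real.sqrt (Real.pi * n.factorial * m'.factorial) : ℂ)⁻¹ *
        (Real.sqrt (Real.pi * n.factorial * m.factorial) : ℂ)⁻¹ *
        (conj (Tbar^[n] (fun w => w ^ m') z) * Tbar^[n] (fun w => w ^ m) z) * gaussWeight z := by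
  have h : gaussWeight z = Complex.exp (-(Complex.normSq z : ℂ) / 2) *
      Complex.exp (-(Complex.normSq z : ℂ) / 2) := by
    rw [← Complex.exp_add, add_halves, gaussWeight]
  have h' : conj (Complex.exp (-(Complex.normSq z : ℂ) / 2)) =
      Complex.exp (-(Complex.normSq z : ℂ) / 2) := by
    simp [← Complex.exp_conj, map_ofNat]
  rw [h, phi, phi]
  simp only [map_mul, map_inv₀, Complex.conj_ofReal, h']
  ring

theorem inv_sqrt_pi_mul_factorial (n m : ℕ) :
    (Real.sqrt (Real.pi * n.factorial * m.factorial) : ℂ)⁻¹ = (Real.sqrt n.factorial : ℂ)⁻¹ *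
      (Real.sqrt (Real.pi * Nat.factorial 0 * m.factorial) : ℂ)⁻¹ := by
  rw [← mul_inv, ← Complex.ofReal_mul, ← Real.sqrt_mul (by positivity)]
  congr 3
  simp
  ring

/-- One-body matrix elements of `V` in the `n`-th Landau level are those of `Lₙ(−¼Δ) V` in the
lowest Landau level. -/
theorem integral_mul_conj_phi_mul_phi {V : ℂ → ℂ} (hV : HasTemperateGrowth V) (n m m' : ℕ) :
    ∫ z, V z * (conj (phi n m' z) * phi n m z) =
      ∫ z, LagOpV n V z * (conj (phi 0 m' z) * phi 0 m z) := by
  have h := integral_Tbar_iterate hV (hasTemperateGrowth_pow m') (by fun_prop)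
    (hasTemperateGrowth_pow m) (by fun_prop) n
  have hn : (Real.sqrt n.factorial : ℂ)⁻¹ * (Real.sqrt n.factorial : ℂ)⁻¹ * n.factorial = 1 := by
    have h0 : (n.factorial : ℂ) ≠ 0 := by exact_mod_cast n.factorial_ne_zero
    rw [← mul_inv, ← Complex.ofReal_mul, Real.mul_self_sqrt (by positivity),
      Complex.ofReal_natCast, inv_mul_cancel₀ h0]
  simp_rw [conj_phi_mul_phi]
  rw [inv_sqrt_pi_mul_factorial n m, inv_sqrt_pi_mul_factorial n m']
  set c := (Real.sqrt (Real.pi * Nat.factorial 0 * m.factorial) : ℂ)⁻¹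
  set c' := (Real.sqrt (Real.pi * Nat.factorial 0 * m'.factorial) : ℂ)⁻¹
  set q := (Real.sqrt n.factorial : ℂ)⁻¹
  calc _ = ∫ z, (q * q * (c * c')) * (V z * conj (Tbar^[n] (fun w => w ^ m') z) *
        Tbar^[n] (fun w => w ^ m) z * gaussWeight z) := by
        congr 1
        ext z
        ring
    _ = (q * q * n.factorial) * (c * c') *
        ∫ z, LagOpV n V z * conj (z ^ m') * z ^ m * gaussWeight z := by
        rw [integral_const_mul, h]
        ring
    _ = _ := by
        rw [hn, one_mul, ← integral_const_mul]
        congr 1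
        ext z
        simp only [iterate_zero, id_eq]
        ring

theorem integrable_pow_mul_norm_mul_gaussWeight {P : ℂ → ℂ} (hP : HasTemperateGrowth P) (k : ℕ) :
    Integrable (fun z => (1 + ‖z‖) ^ k * ‖P z * gaussWeight z‖) := by
  obtain ⟨k', C, h⟩ := hP.norm_le
  refine ((integrable_one_add_norm_pow_mul_exp (k + k')).const_mul C).mono' ?_
    (Filter.Eventually.of_forall fun z => ?_)
  · have h1 := hP.1.continuous
    have h2 := differentiable_gaussWeight.continuous
    exact Continuous.aestronglyMeasurable (by fun_prop)
  · rw [Real.norm_of_nonneg (by positivity), norm_mul, norm_gaussWeight]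
    calc (1 + ‖z‖) ^ k * (‖P z‖ * Real.exp (-‖z‖ ^ 2))
        ≤ (1 + ‖z‖) ^ k * (C * (1 + ‖z‖) ^ k' * Real.exp (-‖z‖ ^ 2)) := by
          gcongr
          exact h z
      _ = _ := by ring

theorem integrable_prod_comp_sub_mul_gaussWeight {u P Q : ℂ → ℂ} (hu : HasTemperateGrowth u)
    (hP : HasTemperateGrowth P) (hQ : HasTemperateGrowth Q) :
    Integrable (fun p : ℂ × ℂ =>
      u (p.1 - p.2) * (P p.1 * gaussWeight p.1) * (Q p.2 * gaussWeight p.2))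
      (volume.prod volume) := by
  obtain ⟨k, C, h⟩ := hu.norm_le
  have hC : 0 ≤ C := by simpa using (norm_nonneg _).trans (h 0)
  have hu' := hu.1.continuous
  have hP' := hP.1.continuous
  have hQ' := hQ.1.continuous
  have hg := differentiable_gaussWeight.continuous
  refine (((integrable_pow_mul_norm_mul_gaussWeight hP k).mul_prod
    (integrable_pow_mul_norm_mul_gaussWeight hQ k)).const_mul C).mono'
    (Continuous.aestronglyMeasurable (by fun_prop)) (Filter.Eventually.of_forall fun p => ?_)
  have hsub : 1 + ‖p.1 - p.2‖ ≤ (1 + ‖p.1‖) * (1 + ‖p.2‖) := by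
    nlinarith [norm_sub_le p.1 p.2, norm_nonneg p.1, norm_nonneg p.2,
      mul_nonneg (norm_nonneg p.1) (norm_nonneg p.2)]
  rw [norm_mul, norm_mul (u _)]
  calc ‖u (p.1 - p.2)‖ * ‖P p.1 * gaussWeight p.1‖ * ‖Q p.2 * gaussWeight p.2‖
      ≤ C * ((1 + ‖p.1‖) * (1 + ‖p.2‖)) ^ k * ‖P p.1 * gaussWeight p.1‖ *
        ‖Q p.2 * gaussWeight p.2‖ := by
        gcongr
        exact (h _).trans (by gcongr)
    _ = _ := by
        rw [mul_pow]
        ring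

theorem exists_conj_phi_mul_phi_eq (n m m' : ℕ) :
    ∃ P : ℂ → ℂ, HasTemperateGrowth P ∧
      ∀ z, conj (phi n m' z) * phi n m z = P z * gaussWeight z := by
  have h1 := (hasTemperateGrowth_pow m).Tbar_iterate n
  have h2 := ((hasTemperateGrowth_pow m').Tbar_iterate n).conj
  exact ⟨_, (HasTemperateGrowth.const _).fun_mul (h2.fun_mul h1), conj_phi_mul_phi n m m'⟩

theorem integral_integral_swap_phi {u : ℂ → ℂ} (hu : HasTemperateGrowth u)
    (n₁ m₁ m₁' n₂ m₂ m₂' : ℕ) :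
    ∫ r₁, ∫ r₂, u (r₁ - r₂) * (conj (phi n₁ m₁' r₁) * phi n₁ m₁ r₁)
        * (conj (phi n₂ m₂' r₂) * phi n₂ m₂ r₂) =
      ∫ r₂, ∫ r₁, u (r₁ - r₂) * (conj (phi n₁ m₁' r₁) * phi n₁ m₁ r₁)
        * (conj (phi n₂ m₂' r₂) * phi n₂ m₂ r₂) := by
  obtain ⟨P, hP, hP'⟩ := exists_conj_phi_mul_phi_eq n₁ m₁ m₁'
  obtain ⟨Q, hQ, hQ'⟩ := exists_conj_phi_mul_phi_eq n₂ m₂ m₂'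
  simp_rw [hP', hQ']
  exact integral_integral_swap (integrable_prod_comp_sub_mul_gaussWeight hu hP hQ)

/-- effective interaction in the `n`-th Landau level: for smooth `w` with
polynomially bounded derivatives, two-body matrix elements of `w` in the `nLL` basis equal
those of `wₙ = Lₙ(−¼Δ)² w` in the `LLL` basis. -/
theorem stmt19 (n : ℕ) (w : ℂ → ℂ) (hw : ContDiff ℝ (⊤ : ℕ∞) w)
    (hpoly : ∀ j : ℕ, ∃ C : ℝ, ∃ p : ℕ, ∀ z : ℂ,
      ‖iteratedFDeriv ℝ j w z‖ ≤ C * (1 + ‖z‖) ^ p) :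
    ∀ m₁ m₂ m₁' m₂' : ℕ,
      (∫ r₁ : ℂ, ∫ r₂ : ℂ, w (r₁ - r₂)
          * (starRingEnd ℂ) (phi n m₁' r₁) * (starRingEnd ℂ) (phi n m₂' r₂)
          * phi n m₁ r₁ * phi n m₂ r₂)
        = ∫ r₁ : ℂ, ∫ r₂ : ℂ, LagOpV n (LagOpV n w) (r₁ - r₂)
            * (starRingEnd ℂ) (phi 0 m₁' r₁) * (starRingEnd ℂ) (phi 0 m₂' r₂)
            * phi 0 m₁ r₁ * phi 0 m₂ r₂ := by
  intro m₁ m₂ m₁' m₂'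
  have hw' : HasTemperateGrowth w :=
    ⟨hw, fun j => let ⟨C, p, h⟩ := hpoly j; ⟨p, C, h⟩⟩
  have hLw := hw'.LagOpV n
  have hreorder (u p q r s : ℂ) : u * p * q * r * s = u * (p * r) * (q * s) := by ring
  have hleft (u p q : ℂ) : u * p * q = p * (u * q) := by ring
  simp_rw [hreorder]
  calc _ = ∫ r₁ : ℂ, ∫ r₂ : ℂ, LagOpV n w (r₁ - r₂) * (conj (phi n m₁' r₁) * phi n m₁ r₁)
        * (conj (phi 0 m₂' r₂) * phi 0 m₂ r₂) := by
        congr 1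
        ext r₁
        generalize conj (phi n m₁' r₁) * phi n m₁ r₁ = p
        simp_rw [hleft]
        rw [integral_const_mul, integral_const_mul, integral_mul_conj_phi_mul_phi
          (V := fun z => w (r₁ - z)) (hw'.comp (.fun_sub (.const r₁) .id')),
          LagOpV_comp_const_sub hw']
    _ = ∫ r₂ : ℂ, ∫ r₁ : ℂ, LagOpV n (LagOpV n w) (r₁ - r₂)
        * (conj (phi 0 m₁' r₁) * phi 0 m₁ r₁) * (conj (phi 0 m₂' r₂) * phi 0 m₂ r₂) := by
        rw [integral_integral_swap_phi hLw]
        congr 1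
        ext r₂
        rw [integral_mul_const, integral_mul_const, integral_mul_conj_phi_mul_phi
          (V := fun z => LagOpV n w (z - r₂)) (hLw.comp (.fun_sub .id' (.const r₂))),
          LagOpV_comp_sub_const hLw]
    _ = _ := (integral_integral_swap_phi (hLw.LagOpV n) 0 m₁ m₁' 0 m₂ m₂').symm
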